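/- arXiv:1406.7414 — 3 statements merged into one kernel-verified Lean document; each statement's English description precedes it below -/
import Mathlib

section
/- Let P be a pree satisfying Axioms A(4) and A(5). Then the canonical map π : P → U(P) from P to its universal group is injective, i.e. P embeds in U(P). -/
/-- A pree: a set with identity, involutive inverse, and a partial multiplication
(represented as an `Option`-valued multiplication) satisfying the pree axioms. -/
structure Pree (α : Type*) where
  one : α
  inv : α → α
  mul : α → α → Option α
  one_mul' : ∀ a, mul one a = some a
  mul_one' : ∀ a, mul a one = some a
  inv_inv' : ∀ a, inv (inv a) = a
  mul_inv' : ∀ a, mul a (inv a) = some one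
  inv_mul' : ∀ a, mul (inv a) a = some one
  assoc_defined : ∀ {a b c x y : α}, mul a b = some x → mul b c = some y →
    ((mul x c).isSome ↔ (mul a y).isSome)
  assoc_eq : ∀ {a b c x y z : α}, mul a b = some x → mul b c = some y →
    mul x c = some z → mul a y = some z

namespace Pree

variable {α : Type*} (P : Pree α)

/-- The relators `a b c⁻¹` for every product `ab = c` defined in `P`. -/
def rels : Set (FreeGroup α) :=
  {r | ∃ a b c : α, P.mul a b = some c ∧
    r = FreeGroup.of a * FreeGroup.of b * (FreeGroup.of c)⁻¹}

/-- The universal group `U(P)` of a pree `P`. -/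
abbrev UniversalGroup := PresentedGroup P.rels

/-- The canonical map `π : P → U(P)`. -/
def pi (a : α) : P.UniversalGroup := PresentedGroup.of a

/-- Axiom A(4). -/
def A4 : Prop := ∀ a₁ a₂ a₃ a₄ b₁ b₂ b₃ b₄ : α,
  P.mul (P.inv a₁) a₂ = some b₁ → P.mul (P.inv a₂) a₃ = some b₂ →
  P.mul (P.inv a₃) a₄ = some b₃ → P.mul (P.inv a₄) a₁ = some b₄ →
  (P.mul b₁ b₂).isSome ∨ (P.mul b₂ b₃).isSome ∨ (P.mul b₃ b₄).isSome ∨ (P.mul b₄ b₁).isSome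

/-- Axiom A(5). -/
def A5 : Prop := ∀ a₁ a₂ a₃ a₄ a₅ b₁ b₂ b₃ b₄ b₅ : α,
  P.mul (P.inv a₁) a₂ = some b₁ → P.mul (P.inv a₂) a₃ = some b₂ →
  P.mul (P.inv a₃) a₄ = some b₃ → P.mul (P.inv a₄) a₅ = some b₄ →
  P.mul (P.inv a₅) a₁ = some b₅ →
  (P.mul b₁ b₂).isSome ∨ (P.mul b₂ b₃).isSome ∨ (P.mul b₃ b₄).isSome ∨
    (P.mul b₄ b₅).isSome ∨ (P.mul b₅ b₁).isSome

/-- A word over `P` is reducible if the product of two successive letters is defined. -/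
def Reducible (w : List α) : Prop :=
  ∃ (u : List α) (a b : α) (v : List α), w = u ++ a :: b :: v ∧ (P.mul a b).isSome

/-- The element of `U(P)` represented by a word over `P`. -/
def wordProd (w : List α) : P.UniversalGroup := (w.map P.pi).prod

end Pree

namespace Pree

variable {α : Type*} {P : Pree α}

universe u

/-! ### Cancellation in a pree -/

theorem assoc_eq_symm {a b c x y z : α} (h₁ : P.mul a b = some x) (h₂ : P.mul b c = some y)
    (h₃ : P.mul a y = some z) : P.mul x c = some z := by
  obtain ⟨w, hw⟩ := Option.isSome_iff_exists.1
    ((P.assoc_defined h₁ h₂).2 (by rw [h₃]; rfl))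
  rw [hw, ← P.assoc_eq h₁ h₂ hw, h₃]

theorem mul_cancel_left {a b c : α} (h : P.mul a b = some c) : P.mul (P.inv a) c = some b :=
  P.assoc_eq (P.inv_mul' a) h (P.one_mul' b)

theorem mul_cancel_right {a b c : α} (h : P.mul a b = some c) : P.mul c (P.inv b) = some a :=
  assoc_eq_symm h (P.mul_inv' b) (P.mul_one' a)

theorem mul_cancel_left_inv {a b c : α} (h : P.mul (P.inv a) b = some c) :
    P.mul a c = some b := by
  simpa [P.inv_inv'] using mul_cancel_left h

theorem mul_inv_rev {a b c : α} (h : P.mul a b = some c) :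
    P.mul (P.inv b) (P.inv a) = some (P.inv c) :=
  mul_cancel_left (mul_cancel_right (mul_cancel_left h))

theorem eq_of_mul_eq_left {a a' b c : α} (h : P.mul a b = some c) (h' : P.mul a' b = some c) :
    a = a' :=
  Option.some.inj ((mul_cancel_right h).symm.trans (mul_cancel_right h'))

theorem eq_of_mul_eq_right {a b b' c : α} (h : P.mul a b = some c) (h' : P.mul a b' = some c) :
    b = b' :=
  Option.some.inj ((mul_cancel_left h).symm.trans (mul_cancel_left h'))

theorem inv_injective : Function.Injective P.inv := fun a b h => by
  rw [← P.inv_inv' a, h, P.inv_inv']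

theorem inv_one : P.inv P.one = P.one :=
  Option.some.inj ((P.one_mul' _).symm.trans (P.mul_inv' _))

/-! ### The link graph -/

variable (P) in
/-- Adjacency in the link of a vertex of the Cayley complex: `a⁻¹ b` is defined. -/
def Adj (a b : α) : Prop := ∃ c, P.mul (P.inv a) b = some c

theorem Adj.symm {a b : α} : P.Adj a b → P.Adj b a := fun ⟨c, h⟩ =>
  ⟨P.inv c, by simpa [P.inv_inv'] using mul_inv_rev h⟩

theorem adj_of_mul {a b c d e f : α} (h₁ : P.mul (P.inv a) b = some d)
    (h₂ : P.mul (P.inv b) c = some e) (h : P.mul d e = some f) : P.Adj a c :=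
  ⟨f, assoc_eq_symm (mul_cancel_right h₁) h₂ h⟩

theorem A4.chord (h4 : P.A4) {a b c d : α} (h₁ : P.Adj a b) (h₂ : P.Adj b c) (h₃ : P.Adj c d)
    (h₄ : P.Adj d a) : P.Adj a c ∨ P.Adj b d := by
  obtain ⟨x, hx⟩ := h₁
  obtain ⟨y, hy⟩ := h₂
  obtain ⟨z, hz⟩ := h₃
  obtain ⟨w, hw⟩ := h₄
  have := h4 a b c d x y z w hx hy hz hw
  simp only [Option.isSome_iff_exists] at this
  rcases this with ⟨_, h⟩ | ⟨_, h⟩ | ⟨_, h⟩ | ⟨_, h⟩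
  · exact .inl (adj_of_mul hx hy h)
  · exact .inr (adj_of_mul hy hz h)
  · exact .inl (adj_of_mul hz hw h).symm
  · exact .inr (adj_of_mul hw hx h).symm

theorem A5.chord (h5 : P.A5) (h4 : P.A4) {a b c d e : α} (h₁ : P.Adj a b) (h₂ : P.Adj b c)
    (h₃ : P.Adj c d) (h₄ : P.Adj d e) (h₅ : P.Adj e a) :
    P.Adj a c ∨ P.Adj a d ∨ P.Adj b e := by
  have key : P.Adj a c ∨ P.Adj b d ∨ P.Adj c e ∨ P.Adj d a ∨ P.Adj e b := by
    obtain ⟨x, hx⟩ := h₁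
    obtain ⟨y, hy⟩ := h₂
    obtain ⟨z, hz⟩ := h₃
    obtain ⟨w, hw⟩ := h₄
    obtain ⟨t, ht⟩ := h₅
    have := h5 a b c d e x y z w t hx hy hz hw ht
    simp only [Option.isSome_iff_exists] at this
    rcases this with ⟨_, h⟩ | ⟨_, h⟩ | ⟨_, h⟩ | ⟨_, h⟩ | ⟨_, h⟩
    · exact .inl (adj_of_mul hx hy h)
    · exact .inr (.inl (adj_of_mul hy hz h))
    · exact .inr (.inr (.inl (adj_of_mul hz hw h)))
    · exact .inr (.inr (.inr (.inl (adj_of_mul hw ht h))))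
    · exact .inr (.inr (.inr (.inr (adj_of_mul ht hx h))))
  rcases key with h | h | h | h | h
  · exact .inl h
  · exact .inr (h4.chord h₁ h h₄ h₅)
  · exact (h4.chord h₁ h₂ h h₅).imp_right .inr
  · exact .inr (.inl h.symm)
  · exact .inr (.inr h.symm)

/-! ### Balls in the Cayley graph -/

/-- A combinatorial model on the vertex set `V` of the ball of radius `n` about the identity in the
Cayley graph of the universal group with respect to the generating set `P`. `E v a w` means that
`w` is obtained from `v` by right multiplication with `a`. -/
structure CayleyBall (P : Pree α) (n : ℕ) (V : Type*) where
  E : V → α → V → Prop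
  level : V → ℕ
  refl : ∀ v, E v P.one v
  symm : ∀ {v a w}, E v a w → E w (P.inv a) v
  comp : ∀ {v a w b x c}, E v a w → E w b x → P.mul a b = some c → E v c x
  target_unique : ∀ {v a w w'}, E v a w → E v a w' → w = w'
  label_unique : ∀ {v a b w}, E v a w → E v b w → a = b
  level_le : ∀ v, level v ≤ n
  level_step : ∀ {v a w}, E v a w → level w ≤ level v + 1
  exists_base : ∃ v, level v = 0
  full : ∀ {v}, level v < n → ∀ a, ∃ w, E v a w
  adj_of_lower : ∀ {v a x b y}, E v a x → E v b y → level x < level v → level y < level v →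
    P.Adj a b
  exists_lower : ∀ {v a w}, E v a w → level v = level w →
    a = P.one ∨ ∃ x b, E v b x ∧ level x < level v ∧ P.Adj a b

namespace CayleyBall

/-- The ball of radius `0`. -/
def point (P : Pree α) : CayleyBall P 0 PUnit where
  E _ a _ := a = P.one
  level _ := 0
  refl _ := rfl
  symm := by rintro _ _ _ rfl; exact inv_one
  comp := by
    rintro _ _ _ _ _ c rfl rfl h
    exact (Option.some.inj ((P.one_mul' _).symm.trans h)).symm
  target_unique _ _ := rfl
  label_unique h h' := h.trans h'.symm
  level_le _ := le_rfl
  level_step _ := Nat.zero_le _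
  exists_base := ⟨⟨⟩, rfl⟩
  full h := absurd h (lt_irrefl _)
  adj_of_lower _ _ h := absurd h (lt_irrefl _)
  exists_lower h _ := .inl h

variable {n : ℕ} {V : Type*} (B : CayleyBall P n V)

theorem comp_inv {v a w b x c} (h₁ : B.E v a w) (h₂ : B.E v b x)
    (h : P.mul (P.inv a) b = some c) : B.E w c x :=
  B.comp (B.symm h₁) h₂ h

/-- The germs of edges leaving the ball. -/
def Exit : Type _ := {p : V × α // B.level p.1 = n ∧ ∀ w, ¬ B.E p.1 p.2 w}

variable {B} in
/-- Two exits lead to the same vertex of the next sphere. -/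
def Exit.Rel (p q : B.Exit) : Prop :=
  ∃ a, B.E p.1.1 a q.1.1 ∧ P.mul a q.1.2 = some p.1.2

variable {B} in
theorem Exit.Rel.trans (h4 : P.A4) (h5 : P.A5) {p q r : B.Exit} (hpq : p.Rel q) (hqr : q.Rel r) :
    p.Rel r := by
  obtain ⟨f, hE, hf⟩ := hpq
  obtain ⟨g, hE', hg⟩ := hqr
  suffices P.Adj (P.inv f) g by
    obtain ⟨k, hk⟩ := this
    rw [P.inv_inv'] at hk
    exact ⟨k, B.comp hE hE' hk, assoc_eq_symm hk hg hf⟩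
  have notAdj {x b} (hx : B.E q.1.1 b x) (hl : B.level x < B.level q.1.1) :
      ¬ P.Adj q.1.2 b := fun hadj => by
    obtain ⟨c, hc⟩ := hadj.symm
    obtain ⟨y, hy⟩ := B.full (hl.trans_eq q.2.1) c
    exact q.2.2 y (B.comp hx hy (mul_cancel_left_inv hc))
  rcases B.exists_lower (B.symm hE) (q.2.1.trans p.2.1.symm) with h1 | ⟨x, b, hx, hxl, hab⟩
  · exact ⟨g, by rw [h1, inv_one, P.one_mul']⟩
  rcases B.exists_lower hE' (q.2.1.trans r.2.1.symm) with rfl | ⟨y, c, hy, hyl, hac⟩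
  · exact ⟨f, by rw [P.inv_inv', P.mul_one']⟩
  have h₁ : P.Adj q.1.2 (P.inv f) := ⟨_, mul_inv_rev hf⟩
  have h₂ : P.Adj g q.1.2 := ⟨_, mul_cancel_left hg⟩
  rcases h5.chord h4 h₁ hab (B.adj_of_lower hx hy hxl hyl) hac.symm h₂ with h | h | h
  · exact absurd h (notAdj hx hxl)
  · exact absurd h (notAdj hy hyl)
  · exact h

/-- The vertices of the next sphere. -/
def exitSetoid (h4 : P.A4) (h5 : P.A5) : Setoid B.Exit where
  r := Exit.Rel
  iseqv :=
    { refl := fun _ => ⟨P.one, B.refl _, P.one_mul' _⟩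
      symm := fun ⟨a, hE, h⟩ => ⟨P.inv a, B.symm hE, mul_cancel_left h⟩
      trans := Exit.Rel.trans h4 h5 }

section Extend

variable (h4 : P.A4) (h5 : P.A5)

/-- The sphere around a ball. -/
abbrev Sphere : Type _ := Quotient (B.exitSetoid h4 h5)

/-- The exit `(v, a)` leads to the vertex `z` of the next sphere. -/
def Up (v : V) (a : α) (z : B.Sphere h4 h5) : Prop :=
  ∃ h, z = Quotient.mk _ (⟨(v, a), h⟩ : B.Exit)

variable {B h4 h5}

theorem Up.level_eq {v a} {z : B.Sphere h4 h5} (h : B.Up h4 h5 v a z) : B.level v = n := h.1.1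

theorem Up.not_E {v a w} {z : B.Sphere h4 h5} (h : B.Up h4 h5 v a z) : ¬ B.E v a w := h.1.2 w

theorem Up.target_unique {v a} {z z' : B.Sphere h4 h5} (h : B.Up h4 h5 v a z)
    (h' : B.Up h4 h5 v a z') : z = z' := by
  obtain ⟨_, rfl⟩ := h
  obtain ⟨_, rfl⟩ := h'
  rfl

theorem Up.exists_E {v a w b} {z : B.Sphere h4 h5} (h : B.Up h4 h5 v a z)
    (h' : B.Up h4 h5 w b z) : ∃ g, B.E v g w ∧ P.mul g b = some a := by
  obtain ⟨_, rfl⟩ := h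
  obtain ⟨_, h'⟩ := h'
  exact Quotient.exact h'

theorem Up.label_unique {v a b} {z : B.Sphere h4 h5} (h : B.Up h4 h5 v a z)
    (h' : B.Up h4 h5 v b z) : a = b := by
  obtain ⟨g, hE, hg⟩ := h.exists_E h'
  rw [B.label_unique hE (B.refl v), P.one_mul'] at hg
  exact (Option.some.inj hg).symm

theorem Up.of_E {v a w b c} {z : B.Sphere h4 h5} (hE : B.E v a w) (h : B.Up h4 h5 w b z)
    (hc : P.mul a b = some c) : B.Up h4 h5 v c z := by
  have hn : ∀ y, ¬ B.E v c y := fun y hy => h.not_E (B.comp_inv hE hy (mul_cancel_left hc))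
  have hl : B.level v = n := (B.level_le v).antisymm <| not_lt.1 fun hlt =>
    (B.full hlt c).elim hn
  obtain ⟨_, rfl⟩ := h
  refine ⟨⟨hl, hn⟩, Quotient.sound ⟨P.inv a, B.symm hE, mul_cancel_left hc⟩⟩

theorem exists_up (z : B.Sphere h4 h5) : ∃ v a, B.Up h4 h5 v a z := by
  induction z using Quotient.inductionOn with
  | h p => exact ⟨p.1.1, p.1.2, p.2, rfl⟩

variable (B h4 h5) in
/-- Adjacency within the next sphere. -/
def Level (z : B.Sphere h4 h5) (f : α) (z' : B.Sphere h4 h5) : Prop :=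
  ∃ v a b, B.Up h4 h5 v a z ∧ B.Up h4 h5 v b z' ∧ P.mul a f = some b

theorem Level.symm {z f} {z' : B.Sphere h4 h5} : B.Level h4 h5 z f z' →
    B.Level h4 h5 z' (P.inv f) z := fun ⟨v, a, b, ha, hb, h⟩ =>
  ⟨v, b, a, hb, ha, mul_cancel_right h⟩

theorem Up.comp_level {v a b c} {z z' : B.Sphere h4 h5} (h : B.Up h4 h5 v a z)
    (h' : B.Level h4 h5 z b z') (hc : P.mul a b = some c) : B.Up h4 h5 v c z' := by
  obtain ⟨u, d, e, hd, he, hde⟩ := h'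
  obtain ⟨g, hE, hg⟩ := h.exists_E hd
  exact he.of_E hE (P.assoc_eq hg hde hc)

theorem Level.target_unique {z f} {z' z'' : B.Sphere h4 h5} (h : B.Level h4 h5 z f z')
    (h' : B.Level h4 h5 z f z'') : z' = z'' := by
  obtain ⟨v, a, b, ha, hb, hab⟩ := h
  exact hb.target_unique (ha.comp_level h' hab)

theorem Level.label_unique {z f g} {z' : B.Sphere h4 h5} (h : B.Level h4 h5 z f z')
    (h' : B.Level h4 h5 z g z') : f = g := by
  obtain ⟨v, a, b, ha, hb, hab⟩ := h
  obtain ⟨u, d, e, hd, he, hde⟩ := h'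
  obtain ⟨k, hE, hk⟩ := ha.exists_E hd
  obtain ⟨k', hE', hk'⟩ := hb.exists_E he
  obtain rfl := B.label_unique hE hE'
  have hag : P.mul a g = some b := assoc_eq_symm hk hde hk'
  exact eq_of_mul_eq_right hab hag

theorem Level.comp {x y z : B.Sphere h4 h5} {a b c} (h : B.Level h4 h5 x a y)
    (h' : B.Level h4 h5 y b z) (hc : P.mul a b = some c) : B.Level h4 h5 x c z := by
  obtain ⟨p, e, e', he, he', hee⟩ := h
  obtain ⟨q, d, d', hd, hd', hdd⟩ := id h'
  obtain ⟨g, hE, hg⟩ := he'.exists_E hd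
  have h₁ : P.Adj (P.inv a) b := ⟨c, by rwa [P.inv_inv']⟩
  have h₂ : P.Adj b (P.inv d) := Adj.symm ⟨d', by rwa [P.inv_inv']⟩
  have h₃ : P.Adj (P.inv d) (P.inv e') :=
    Adj.symm ⟨g, by rw [P.inv_inv']; exact mul_cancel_right hg⟩
  have h₄ : P.Adj (P.inv e') (P.inv a) := ⟨e, by rw [P.inv_inv']; exact mul_cancel_right hee⟩
  rcases h4.chord h₁ h₂ h₃ h₄ with h | h
  · obtain ⟨k, hk⟩ := h.symm
    rw [P.inv_inv'] at hk
    have hka := mul_cancel_right hk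
    rw [P.inv_inv'] at hka
    exact ⟨q, k, d', hd.comp_level ⟨p, e', e, he', he, mul_cancel_right hee⟩ hk, hd',
      P.assoc_eq hka hc hdd⟩
  · obtain ⟨k, hk⟩ := h.symm
    rw [P.inv_inv'] at hk
    exact ⟨p, e, k, he, he'.comp_level h' hk, P.assoc_eq hee hc hk⟩

variable (B h4 h5)

/-- Edges of the ball of radius `n + 1`. -/
def extendE : V ⊕ B.Sphere h4 h5 → α → V ⊕ B.Sphere h4 h5 → Prop
  | .inl v, a, .inl w => B.E v a w
  | .inl v, a, .inr z => B.Up h4 h5 v a z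
  | .inr z, a, .inl v => B.Up h4 h5 v (P.inv a) z
  | .inr z, a, .inr z' => B.Level h4 h5 z a z'

/-- The ball of radius `n + 1` built from the ball of radius `n`. -/
def extend : CayleyBall P (n + 1) (V ⊕ B.Sphere h4 h5) where
  E := B.extendE h4 h5
  level := Sum.elim B.level fun _ => n + 1
  refl := by
    rintro (v | z)
    · exact B.refl v
    · obtain ⟨v, a, h⟩ := exists_up z
      exact ⟨v, a, a, h, h, P.mul_one' a⟩
  symm := by
    rintro (v | z) a (w | z') h
    · exact B.symm h
    · simpa [extendE, P.inv_inv'] using h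
    · exact h
    · exact Level.symm h
  comp := by
    rintro (v | v) a (w | w) b (x | x) c h h' hc
    · exact B.comp h h' hc
    · exact Up.of_E h h' hc
    · obtain ⟨g, hE, hg⟩ := Up.exists_E h h'
      have := mul_cancel_right hg
      rw [P.inv_inv', hc] at this
      obtain rfl := Option.some.inj this
      exact hE
    · exact Up.comp_level h h' hc
    · exact Up.of_E (B.symm h') h (mul_inv_rev hc)
    · exact ⟨w, _, _, h, h', mul_cancel_left hc⟩
    · exact Up.comp_level h' (Level.symm h) (mul_inv_rev hc)
    · exact Level.comp h h' hc
  target_unique := by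
    have key {z f w} {z' : B.Sphere h4 h5} (h : B.Up h4 h5 w (P.inv f) z)
        (h' : B.Level h4 h5 z f z') : False :=
      (h.comp_level h' (P.inv_mul' f)).not_E (B.refl w)
    rintro (v | z) a (w | w) (w' | w') h h'
    · exact congrArg _ (B.target_unique h h')
    · exact absurd h (Up.not_E h')
    · exact absurd h' (Up.not_E h)
    · exact congrArg _ (Up.target_unique h h')
    · obtain ⟨g, hE, hg⟩ := Up.exists_E h h'
      rw [eq_of_mul_eq_left hg (P.one_mul' _)] at hE
      exact congrArg _ (B.target_unique (B.refl w) hE)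
    · exact (key h h').elim
    · exact (key h' h).elim
    · exact congrArg _ (Level.target_unique h h')
  label_unique := by
    rintro (v | z) a b (w | w) h h'
    · exact B.label_unique h h'
    · exact Up.label_unique h h'
    · exact inv_injective (Up.label_unique h h')
    · exact Level.label_unique h h'
  level_le := by
    rintro (v | z)
    · exact (B.level_le v).trans n.le_succ
    · exact le_rfl
  level_step := by
    rintro (v | z) a (w | z') h
    · exact B.level_step h
    · exact (congrArg (· + 1) (Up.level_eq h)).ge
    · exact ((B.level_le w).trans n.le_succ).trans (Nat.le_succ _)
    · exact Nat.le_succ _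
  exists_base := B.exists_base.imp' Sum.inl fun _ h => h
  full := by
    rintro (v | z) hv a
    · by_cases h : ∃ w, B.E v a w
      · exact h.imp' Sum.inl fun _ h => h
      · have hl : B.level v = n := (B.level_le v).antisymm <| not_lt.1 fun hlt =>
          h (B.full hlt a)
        exact ⟨.inr _, ⟨hl, not_exists.1 h⟩, rfl⟩
    · exact absurd hv (lt_irrefl _)
  adj_of_lower := by
    rintro (v | z) a (x | x) b (y | y) h h' hx hy
    · exact B.adj_of_lower h h' hx hy
    · exact absurd (hy.trans_le (B.level_le v)) (by simp)
    · exact absurd (hx.trans_le (B.level_le v)) (by simp)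
    · exact absurd (hx.trans_le (B.level_le v)) (by simp)
    · obtain ⟨g, -, hg⟩ := Up.exists_E h h'
      exact ⟨g, by simpa [P.inv_inv'] using mul_cancel_right hg⟩
    · exact absurd hy (lt_irrefl _)
    · exact absurd hx (lt_irrefl _)
    · exact absurd hx (lt_irrefl _)
  exists_lower := by
    rintro (v | z) a (w | z') h hl
    · refine (B.exists_lower h hl).imp_right ?_
      rintro ⟨x, b, h⟩
      exact ⟨.inl x, b, h⟩
    · exact absurd ((B.level_le v).trans_lt n.lt_succ_self) hl.not_lt
    · exact absurd ((B.level_le w).trans_lt n.lt_succ_self) hl.not_gt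
    · obtain ⟨v, b, c, hb, hc, hbc⟩ := h
      refine .inr ⟨.inl v, P.inv b, ?_, Nat.lt_succ_of_le (B.level_le v), _, mul_inv_rev hbc⟩
      simpa [extendE, P.inv_inv'] using hb

end Extend

theorem exists_cayleyBall {α : Type u} {P : Pree α} (h4 : P.A4) (h5 : P.A5) (n : ℕ) :
    ∃ V : Type u, Nonempty (CayleyBall P n V) := by
  induction n with
  | zero => exact ⟨_, ⟨point P⟩⟩
  | succ n ih =>
    obtain ⟨V, ⟨B⟩⟩ := ih
    exact ⟨_, ⟨B.extend h4 h5⟩⟩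

/-! ### Walks in balls -/

/-- The walk from `v` labelled by `l` exists and ends at `w`. -/
def Walk : V → List α → V → Prop
  | v, [], w => v = w
  | v, a :: l, w => ∃ x, B.E v a x ∧ Walk x l w

variable {B}

theorem walk_append {v w : V} {l l' : List α} :
    B.Walk v (l ++ l') w ↔ ∃ x, B.Walk v l x ∧ B.Walk x l' w := by
  induction l generalizing v with
  | nil => simp [Walk]
  | cons a l ih =>
    simp only [List.cons_append, Walk, ih]
    tauto

theorem Walk.level_le {v w : V} {l : List α} (h : B.Walk v l w) :
    B.level w ≤ B.level v + l.length := by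
  induction l generalizing v with
  | nil => obtain rfl := h; simp
  | cons a l ih =>
    obtain ⟨x, hE, h⟩ := h
    have := ih h
    have := B.level_step hE
    simp only [List.length_cons]
    omega

end CayleyBall

/-! ### The group of walks -/

/-- Words are congruent when they label walks with the same ends, away from the boundary of every
ball. -/
def walkCon {α : Type u} (P : Pree α) : Con (FreeMonoid α) where
  r l l' := ∃ N, ∀ (n : ℕ) (V : Type u) (B : CayleyBall P n V) (v w : V), B.level v + N ≤ n →
    (B.Walk v l.toList w ↔ B.Walk v l'.toList w)
  iseqv :=
    { refl := fun _ => ⟨0, fun _ _ _ _ _ _ => Iff.rfl⟩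
      symm := fun ⟨N, h⟩ => ⟨N, fun n V B v w hv => (h n V B v w hv).symm⟩
      trans := fun ⟨N, h⟩ ⟨N', h'⟩ => ⟨N + N', fun n V B v w hv =>
        (h n V B v w (by omega)).trans (h' n V B v w (by omega))⟩ }
  mul' := by
    rintro k k' l l' ⟨N, h⟩ ⟨N', h'⟩
    refine ⟨N + N' + k.toList.length, fun n V B v w hv => ?_⟩
    simp only [FreeMonoid.toList_mul, CayleyBall.walk_append, ← h n V B v _ (by omega)]
    refine exists_congr fun x => and_congr_right fun hx => h' n V B x w ?_
    have := hx.level_le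
    omega

section WalkMonoid

variable {α : Type u} (P : Pree α)

/-- The class of a generator modulo `walkCon`. -/
def walkOf (a : α) : P.walkCon.Quotient := (FreeMonoid.of a : FreeMonoid α)

theorem walkOf_one : P.walkOf P.one = 1 := by
  refine (Con.eq _).2 ⟨0, fun n V B v w _ => ?_⟩
  simp only [FreeMonoid.toList_of, FreeMonoid.toList_one, CayleyBall.Walk, exists_eq_right]
  exact ⟨fun h => B.target_unique (B.refl v) h, fun h => h ▸ B.refl v⟩

variable {P} in
theorem walkOf_mul {a b c : α} (h : P.mul a b = some c) :
    P.walkOf a * P.walkOf b = P.walkOf c := by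
  refine (Con.eq _).2 ⟨1, fun n V B v w hv => ?_⟩
  simp only [FreeMonoid.toList_mul, FreeMonoid.toList_of, List.singleton_append,
    CayleyBall.Walk, exists_eq_right]
  refine ⟨fun ⟨x, hx, hw⟩ => B.comp hx hw h, fun hw => ?_⟩
  obtain ⟨x, hx⟩ := B.full (v := v) (by omega) a
  exact ⟨x, hx, B.comp_inv hx hw (mul_cancel_left h)⟩

/-- The generators are units modulo `walkCon`. -/
def walkUnit (a : α) : P.walkCon.Quotientˣ where
  val := P.walkOf a
  inv := P.walkOf (P.inv a)
  val_inv := (walkOf_mul (P.mul_inv' a)).trans P.walkOf_one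
  inv_val := (walkOf_mul (P.inv_mul' a)).trans P.walkOf_one

/-- The universal group acts by walks. -/
def toWalkUnits : P.UniversalGroup →* P.walkCon.Quotientˣ :=
  PresentedGroup.toGroup (f := P.walkUnit) <| by
    rintro _ ⟨a, b, c, h, rfl⟩
    simp only [map_mul, map_inv, FreeGroup.lift_apply_of]
    exact mul_inv_eq_one.2 (Units.ext (walkOf_mul h))

variable {P} in
theorem walkOf_injective (h4 : P.A4) (h5 : P.A5) : Function.Injective P.walkOf := by
  intro a b hab
  obtain ⟨N, hN⟩ := (Con.eq _).1 hab
  obtain ⟨V, ⟨B⟩⟩ := CayleyBall.exists_cayleyBall h4 h5 (N + 1)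
  obtain ⟨v, hv⟩ := B.exists_base
  obtain ⟨w, hw⟩ := B.full (v := v) (by omega) a
  have := (hN _ V B v w (by omega)).1 ⟨w, hw, rfl⟩
  obtain ⟨x, hx, rfl⟩ := this
  exact B.label_unique hw hx

end WalkMonoid

end Pree

/-- If a pree `P` satisfies Axioms A(4) and A(5), then the canonical map
`π : P → U(P)` is injective. -/
theorem pree_embeds_in_universal_group {α : Type*} (P : Pree α)
    (h4 : P.A4) (h5 : P.A5) : Function.Injective P.pi := by
  intro a b hab
  have h := congrArg P.toWalkUnits hab
  simp only [Pree.toWalkUnits, Pree.pi, PresentedGroup.toGroup.of] at h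
  exact Pree.walkOf_injective h4 h5 (congrArg Units.val h)
end

section
/- Every finitely presented group is the universal group of a finite pree: if G is a finitely presented group, then there exists a finite pree P such that U(P) is isomorphic to G. -/
namespace Pree

section OfInjective

variable {α H : Type*} [Group H]

open Classical in
/-- The partial multiplication on `α` induced by a map `f` into a group: the product `ab` is
defined when `f a * f b` lies in the range of `f`. -/
noncomputable def inducedMul (f : α → H) (a b : α) : Option α :=
  if h : ∃ c, f c = f a * f b then some h.choose else none

theorem inducedMul_eq_some_iff {f : α → H} (hf : Function.Injective f) {a b c : α} :
    inducedMul f a b = some c ↔ f a * f b = f c := by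
  unfold inducedMul
  split_ifs with h
  · rw [Option.some_inj, ← hf.eq_iff, h.choose_spec]
  · simp only [false_iff]
    exact fun hc => h ⟨c, hc.symm⟩

theorem isSome_inducedMul_iff {f : α → H} (hf : Function.Injective f) {a b : α} :
    (inducedMul f a b).isSome ↔ ∃ c, f a * f b = f c := by
  simp only [Option.isSome_iff_exists, inducedMul_eq_some_iff hf]

/-- A subset of a group which contains `1` and is closed under inversion, given as the range of
an injective map, is a pree. -/
noncomputable def ofInjective (f : α → H) (hf : Function.Injective f)
    (one : α) (hone : f one = 1) (inv : α → α) (hinv : ∀ a, f (inv a) = (f a)⁻¹) : Pree α where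
  one := one
  inv := inv
  mul := inducedMul f
  one_mul' a := by simp [inducedMul_eq_some_iff hf, hone]
  mul_one' a := by simp [inducedMul_eq_some_iff hf, hone]
  inv_inv' a := hf (by simp [hinv])
  mul_inv' a := by simp [inducedMul_eq_some_iff hf, hone, hinv]
  inv_mul' a := by simp [inducedMul_eq_some_iff hf, hone, hinv]
  assoc_defined hx hy := by
    rw [inducedMul_eq_some_iff hf] at hx hy
    rw [isSome_inducedMul_iff hf, isSome_inducedMul_iff hf, ← hx, ← hy, mul_assoc]
  assoc_eq hx hy hz := by
    rw [inducedMul_eq_some_iff hf] at hx hy hz ⊢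
    rw [← hz, ← hx, ← hy, mul_assoc]

end OfInjective

section UniversalGroup

variable {α : Type*} (P : Pree α)

theorem pi_mul_pi {a b c : α} (h : P.mul a b = some c) : P.pi a * P.pi b = P.pi c := by
  have : PresentedGroup.mk P.rels
      (FreeGroup.of a * FreeGroup.of b * (FreeGroup.of c)⁻¹) = 1 :=
    PresentedGroup.one_of_mem ⟨a, b, c, h, rfl⟩
  rw [map_mul, map_mul, map_inv] at this
  exact mul_inv_eq_one.mp this

theorem pi_one : P.pi P.one = 1 := by
  simpa using P.pi_mul_pi (P.one_mul' P.one)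

theorem pi_inv (a : α) : P.pi (P.inv a) = (P.pi a)⁻¹ := by
  rw [← mul_eq_one_iff_eq_inv, P.pi_mul_pi (P.inv_mul' a), pi_one]

/-- The homomorphism out of `U(P)` induced by a map preserving the defined products. -/
def lift {H : Type*} [Group H] (f : α → H)
    (hf : ∀ a b c, P.mul a b = some c → f a * f b = f c) : P.UniversalGroup →* H :=
  PresentedGroup.toGroup (f := f) (by
    rintro _ ⟨a, b, c, h, rfl⟩
    simp [hf a b c h])

@[simp]
theorem lift_pi {H : Type*} [Group H] (f : α → H)
    (hf : ∀ a b c, P.mul a b = some c → f a * f b = f c) (a : α) :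
    P.lift f hf (P.pi a) = f a :=
  PresentedGroup.toGroup.of _

end UniversalGroup

section Ball

variable {ι : Type*} (rels : Set (FreeGroup ι))

/-- The ball of radius `N` in the Cayley graph of a presented group. -/
def ball (N : ℕ) : Set (PresentedGroup rels) :=
  Set.image (fun L : List (ι × Bool) => PresentedGroup.mk rels (FreeGroup.mk L))
    {L | L.length ≤ N}

theorem ball_finite [Finite ι] (N : ℕ) : (ball rels N).Finite :=
  (List.finite_length_le _ N).image _

variable {rels} {α : Type*} {N : ℕ}

theorem one_mem_ball : 1 ∈ ball rels N :=
  ⟨[], by simp, map_one _⟩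

theorem of_mem_ball (hN : 1 ≤ N) (i : ι) : PresentedGroup.of i ∈ ball rels N :=
  ⟨[(i, true)], by simpa using hN, rfl⟩

theorem inv_mem_ball {x : PresentedGroup rels} (hx : x ∈ ball rels N) : x⁻¹ ∈ ball rels N := by
  obtain ⟨L, hL, rfl⟩ := hx
  exact ⟨FreeGroup.invRev L, by simpa using hL, by simp only [← FreeGroup.inv_mk, map_inv]⟩

/-- In the universal group of a pree on the ball of radius `N`, a word of length at most `N`
evaluates to the element of the ball it represents. -/
theorem freeGroup_lift_eq_pi (P : Pree α) (f : α → PresentedGroup rels)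
    (hmul : ∀ a b c, P.mul a b = some c ↔ f a * f b = f c)
    (hball : ∀ x, x ∈ ball rels N → ∃ a, f a = x)
    (gen : ι → α) (hgen : ∀ i, f (gen i) = PresentedGroup.of i)
    (L : List (ι × Bool)) (hL : L.length ≤ N) (a : α)
    (ha : f a = PresentedGroup.mk rels (FreeGroup.mk L)) :
    FreeGroup.lift (fun i => P.pi (gen i)) (FreeGroup.mk L) = P.pi a := by
  have hinv (b : α) : f (P.inv b) = (f b)⁻¹ := by
    have h₁ := (hmul _ _ _).mp (P.inv_mul' b)
    have h₂ := (hmul _ _ _).mp (P.one_mul' P.one)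
    rw [mul_eq_right.mp h₂] at h₁
    exact eq_inv_of_mul_eq_one_left h₁
  induction L generalizing a with
  | nil =>
    have h : P.mul a a = some a := by
      rw [hmul, ha, ← FreeGroup.one_eq_mk, map_one, mul_one]
    rw [← FreeGroup.one_eq_mk, map_one]
    exact (mul_eq_left.mp (P.pi_mul_pi h)).symm
  | cons p L ih =>
    obtain ⟨i, b⟩ := p
    have hL' : L.length ≤ N := (Nat.le_succ _).trans hL
    obtain ⟨c, hc⟩ := hball _ ⟨L, hL', rfl⟩
    have hcons : FreeGroup.mk ((i, b) :: L) = FreeGroup.mk [(i, b)] * FreeGroup.mk L := by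
      rw [FreeGroup.mul_mk, List.singleton_append]
    rw [hcons, map_mul] at ha ⊢
    rw [ih hL' c hc]
    cases b with
    | true =>
      have h : P.mul (gen i) c = some a := by
        rw [hmul, ha, hc, hgen]
        rfl
      rw [← P.pi_mul_pi h]
      exact congrArg (· * P.pi c) FreeGroup.lift_apply_of
    | false =>
      have hof : (FreeGroup.mk [(i, false)] : FreeGroup ι) = (FreeGroup.of i)⁻¹ := rfl
      have h : P.mul (P.inv (gen i)) c = some a := by
        rw [hmul, ha, hc, hinv, hgen, hof, map_inv]
        rfl
      rw [← P.pi_mul_pi h, hof, map_inv, FreeGroup.lift_apply_of, pi_inv]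

/-- If `N ≥ 1` bounds the lengths of the relators, the universal group of the pree on the ball of
radius `N` is the presented group. -/
theorem nonempty_universalGroup_mulEquiv [DecidableEq ι] (P : Pree α) (f : α → PresentedGroup rels)
    (hmul : ∀ a b c, P.mul a b = some c ↔ f a * f b = f c)
    (hball : ∀ x, x ∈ ball rels N ↔ ∃ a, f a = x)
    (hN : 1 ≤ N) (hrels : ∀ r ∈ rels, r.toWord.length ≤ N) :
    Nonempty (P.UniversalGroup ≃* PresentedGroup rels) := by
  choose gen hgen using fun i => (hball _).mp (of_mem_ball hN i)
  have key := P.freeGroup_lift_eq_pi f hmul (fun x => (hball x).mp) gen hgen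
  have hone : f P.one = 1 := mul_eq_right.mp ((hmul _ _ _).mp (P.one_mul' P.one))
  have hlift : ∀ r ∈ rels, FreeGroup.lift (fun i => P.pi (gen i)) r = 1 := by
    intro r hr
    have h := key r.toWord (hrels r hr) P.one (by
      rw [FreeGroup.mk_toWord, hone, PresentedGroup.one_of_mem hr])
    rwa [FreeGroup.mk_toWord, pi_one] at h
  let φ := P.lift f fun a b c => (hmul a b c).mp
  let ψ : PresentedGroup rels →* P.UniversalGroup := PresentedGroup.toGroup hlift
  refine ⟨MonoidHom.toMulEquiv φ ψ (PresentedGroup.ext fun a => ?_)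
    (PresentedGroup.ext fun i => ?_)⟩
  · obtain ⟨L, hL, ha⟩ := (hball (f a)).mpr ⟨a, rfl⟩
    change ψ (φ (P.pi a)) = P.pi a
    rw [lift_pi, ← ha]
    exact key L hL a ha.symm
  · change φ (ψ (PresentedGroup.of i)) = PresentedGroup.of i
    rw [PresentedGroup.toGroup.of, lift_pi, hgen]

end Ball

end Pree

/-- Every finitely presented group is the universal group of a finite pree. -/
theorem finitely_presented_is_universal_group_of_finite_pree (G : Type*) [Group G]
    (hfp : ∃ (n : ℕ) (rels : Finset (FreeGroup (Fin n))),
      Nonempty (G ≃* PresentedGroup (rels : Set (FreeGroup (Fin n))))) :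
    ∃ (m : ℕ) (P : Pree (Fin m)), Nonempty (P.UniversalGroup ≃* G) := by
  obtain ⟨n, rels, ⟨e⟩⟩ := hfp
  let N := rels.sup (fun r => r.toWord.length) + 1
  have hrels : ∀ r ∈ (rels : Set (FreeGroup (Fin n))), r.toWord.length ≤ N := fun r hr =>
    (Finset.le_sup (f := fun r : FreeGroup (Fin n) => r.toWord.length) hr).trans (Nat.le_succ _)
  have : Finite (Pree.ball (rels : Set (FreeGroup (Fin n))) N) := Pree.ball_finite _ N
  obtain ⟨m, ⟨E⟩⟩ := Finite.exists_equiv_fin (Pree.ball (rels : Set (FreeGroup (Fin n))) N)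
  let f : Fin m → PresentedGroup (rels : Set (FreeGroup (Fin n))) := fun a => (E.symm a : _)
  have hf : Function.Injective f := Subtype.val_injective.comp E.symm.injective
  have hball : ∀ x, x ∈ Pree.ball (rels : Set (FreeGroup (Fin n))) N ↔ ∃ a, f a = x := fun x =>
    ⟨fun hx => ⟨E ⟨x, hx⟩, by simp [f]⟩, by rintro ⟨a, rfl⟩; exact (E.symm a).2⟩
  obtain ⟨one, hone⟩ := (hball 1).mp Pree.one_mem_ball
  choose inv hinv using fun a =>
    (hball (f a)⁻¹).mp (Pree.inv_mem_ball ((hball _).mpr ⟨a, rfl⟩))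
  obtain ⟨φ⟩ := (Pree.ofInjective f hf one hone inv hinv).nonempty_universalGroup_mulEquiv f
    (fun _ _ _ => Pree.inducedMul_eq_some_iff hf) hball (Nat.le_add_left 1 _) hrels
  exact ⟨m, _, ⟨φ.trans e.symm⟩⟩
end

section
/- Let P be a pree, let S be the free semigroup on the set P, and let ∼ be the smallest semigroup congruence on S such that ab ∼ c for every product ab = c defined in P (where on the left ab denotes the length-two word and on the right c the length-one word). Then the quotient S/∼ is a group, and it is isomorphic to the universal group U(P) via the map induced by sending each letter a ∈ P to π(a). -/
/-- The smallest semigroup congruence `∼` on the free semigroup over `P` generated by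
`ab ∼ c` for every product `ab = c` defined in `P`. -/
def preeCon {α : Type*} (P : Pree α) : Con (FreeSemigroup α) :=
  conGen (fun x y => ∃ a b c : α, P.mul a b = some c ∧
    x = FreeSemigroup.of a * FreeSemigroup.of b ∧ y = FreeSemigroup.of c)

namespace Pree

variable {α : Type*} (P : Pree α)

/-- The class of a letter in the quotient of the free semigroup. -/
def letter (a : α) : (preeCon P).Quotient :=
  ((FreeSemigroup.of a : FreeSemigroup α) : (preeCon P).Quotient)

theorem letter_mul_letter {a b c : α} (h : P.mul a b = some c) :
    P.letter a * P.letter b = P.letter c :=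
  (Con.eq (preeCon P)).2 (ConGen.Rel.of _ _ ⟨a, b, c, h, rfl, rfl⟩)

theorem quotient_induction {p : (preeCon P).Quotient → Prop}
    (of : ∀ a, p (P.letter a)) (mul : ∀ a x, p x → p (P.letter a * x))
    (x : (preeCon P).Quotient) : p x := by
  induction x using Con.induction_on with
  | H w =>
    induction w using FreeSemigroup.recOnMul with
    | ih1 a => exact of a
    | ih2 a w _ hw => exact mul a w hw

theorem letter_one_mul (x : (preeCon P).Quotient) : P.letter P.one * x = x := by
  induction x using P.quotient_induction with
  | of a => exact P.letter_mul_letter (P.one_mul' a)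
  | mul a x _ => rw [← mul_assoc, P.letter_mul_letter (P.one_mul' a)]

theorem exists_left_inv (x : (preeCon P).Quotient) : ∃ y, y * x = P.letter P.one := by
  induction x using P.quotient_induction with
  | of a => exact ⟨P.letter (P.inv a), P.letter_mul_letter (P.inv_mul' a)⟩
  | mul a x hx =>
    obtain ⟨y, hy⟩ := hx
    refine ⟨y * P.letter (P.inv a), ?_⟩
    rw [mul_assoc, ← mul_assoc (P.letter (P.inv a)), P.letter_mul_letter (P.inv_mul' a),
      P.letter_one_mul, hy]

/-- The group structure on the quotient of the free semigroup. -/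
noncomputable abbrev quotientGroup : Group (preeCon P).Quotient where
  toSemigroup := inferInstance
  __ := @Group.ofLeftAxioms _ _ ⟨fun x => (P.exists_left_inv x).choose⟩ ⟨P.letter P.one⟩
    mul_assoc P.letter_one_mul fun x => (P.exists_left_inv x).choose_spec

/-- The homomorphism to `U(P)` induced by `π`. -/
def toUniversalGroup : (preeCon P).Quotient →ₙ* P.UniversalGroup where
  toFun x := Con.liftOn x (FreeSemigroup.lift P.pi) fun x y h => by
    have hle : preeCon P ≤ Con.ker (FreeSemigroup.lift P.pi) := by
      refine Con.conGen_le.2 ?_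
      rintro _ _ ⟨a, b, c, h, rfl, rfl⟩
      simpa [Con.ker_rel] using P.pi_mul_pi h
    exact hle h
  map_mul' x y := Con.induction_on₂ x y fun v w => map_mul (FreeSemigroup.lift P.pi) v w

theorem toUniversalGroup_letter (a : α) : P.toUniversalGroup (P.letter a) = P.pi a :=
  FreeSemigroup.lift_of P.pi a

theorem exists_mulEquiv_universalGroup :
    ∃ e : (preeCon P).Quotient ≃* P.UniversalGroup, ∀ a, e (P.letter a) = P.pi a := by
  let := P.quotientGroup
  have hrels : ∀ r ∈ P.rels, FreeGroup.lift P.letter r = 1 := by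
    rintro _ ⟨a, b, c, h, rfl⟩
    simpa [mul_inv_eq_one] using P.letter_mul_letter h
  let g : P.UniversalGroup →* (preeCon P).Quotient := PresentedGroup.toGroup hrels
  let f : (preeCon P).Quotient →* P.UniversalGroup :=
    MonoidHom.mk' P.toUniversalGroup (map_mul P.toUniversalGroup)
  have hf (a : α) : f (P.letter a) = P.pi a := P.toUniversalGroup_letter a
  have hg (a : α) : g (P.pi a) = P.letter a := PresentedGroup.toGroup.of hrels
  refine ⟨MonoidHom.toMulEquiv f g ?_ ?_, hf⟩
  · ext x
    induction x using P.quotient_induction with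
    | of a => simp [hf, hg]
    | mul a x hx => simpa [hf, hg] using hx
  · refine PresentedGroup.ext fun a => ?_
    exact (congrArg f (hg a)).trans (hf a)

end Pree

/-- The quotient of the free semigroup on `P` by the congruence generated by
`ab ∼ c` (for defined products `ab = c`) is a group, and it is isomorphic to `U(P)` via the map
induced by `a ↦ π(a)`. -/
theorem free_semigroup_quotient_is_universal_group {α : Type*} (P : Pree α) :
    (∃ (one : (preeCon P).Quotient) (inv : (preeCon P).Quotient → (preeCon P).Quotient),
      (∀ x, one * x = x) ∧ (∀ x, x * one = x) ∧ (∀ x, inv x * x = one)) ∧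
    ∃ e : (preeCon P).Quotient ≃* P.UniversalGroup,
      ∀ a : α, e ((FreeSemigroup.of a : FreeSemigroup α) : (preeCon P).Quotient) = P.pi a := by
  let := P.quotientGroup
  exact ⟨⟨1, Inv.inv, one_mul, mul_one, inv_mul_cancel⟩, P.exists_mulEquiv_universalGroup⟩
end
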